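/- Let k ≥ 2, n ≥ k+2, and let u, v, w be distinct vertices of S_{n,k} such that uv and vw are both star edges. Then there is exactly one star-edge 6-cycle in S_{n,k} containing both edges uv and vw. -/

import Mathlib

open Equiv

/-- Vertices of the `(n,k)`-star graph: `k`-permutations of an `n`-set, i.e.
ordered `k`-tuples of distinct elements (positions and values are `0`-indexed,
so "position 1" of the paper is the index `j : Fin k` with `j.1 = 0`). -/
def StarVertex (n k : ℕ) : Type :=
  {a : Fin k → Fin n // Function.Injective a}

/-- `u` and `v` are joined by a residual edge: they differ exactly in position 1. -/
def IsResEdge {n k : ℕ} (u v : StarVertex n k) : Prop :=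
  (∀ j : Fin k, j.1 = 0 → u.1 j ≠ v.1 j) ∧ ∀ j : Fin k, j.1 ≠ 0 → u.1 j = v.1 j

/-- `u` and `v` are joined by a star edge: `v` is obtained from `u` by exchanging
the entries in position 1 and position `i` for some position `i ≠ 1`. -/
def IsStarEdge {n k : ℕ} (u v : StarVertex n k) : Prop :=
  ∃ i : Fin k, i.1 ≠ 0 ∧
    (∀ j : Fin k, j.1 = 0 → v.1 j = u.1 i ∧ v.1 i = u.1 j) ∧
    ∀ j : Fin k, j.1 ≠ 0 → j ≠ i → v.1 j = u.1 j

/-- The `(n,k)`-star graph `S_{n,k}`. -/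
def starGraph (n k : ℕ) : SimpleGraph (StarVertex n k) :=
  SimpleGraph.fromRel fun u v => IsStarEdge u v ∨ IsResEdge u v

/-- A (finite) graph is a Cayley graph if it is isomorphic to the Cayley graph of some
finite group `G` with connection set `S ⊆ G` satisfying `1 ∉ S` and `S = S⁻¹`. -/
def IsCayleyGraph {V : Type*} (Γ : SimpleGraph V) : Prop :=
  ∃ (G : Type) (_ : Group G) (_ : Fintype G) (S : Set G),
    (1 : G) ∉ S ∧ (∀ s ∈ S, s⁻¹ ∈ S) ∧
    Nonempty (Γ ≃g SimpleGraph.fromRel fun g h : G => g⁻¹ * h ∈ S)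

/-- The automorphism group of a graph, as a subgroup of the permutation group
of the vertex set. -/
def graphAut {V : Type*} (Γ : SimpleGraph V) : Subgroup (Equiv.Perm V) where
  carrier := {σ | ∀ u w : V, Γ.Adj (σ u) (σ w) ↔ Γ.Adj u w}
  one_mem' := by intro u w; simp
  mul_mem' := by
    intro a b ha hb u w
    rw [Equiv.Perm.mul_apply, Equiv.Perm.mul_apply, ha, hb]
  inv_mem' := by
    intro a ha u w
    simpa using (ha (a⁻¹ u) (a⁻¹ w)).symm

/-- The copy of `S_{k-1}` inside the symmetric group on the `k` positions:
permutations of the positions `2,…,k` fixing position `1`. (Via the further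
identification of positions `2,…,k` with the corresponding points, this is the
subgroup `S_{k-1} ≤ S_n` of the paper.) -/
def SkSub (k : ℕ) : Subgroup (Equiv.Perm (Fin k)) where
  carrier := {ν | ∀ j : Fin k, j.1 = 0 → ν j = j}
  one_mem' := by intro j hj; simp
  mul_mem' := by
    intro a b ha hb j hj
    rw [Equiv.Perm.mul_apply, hb j hj, ha j hj]
  inv_mem' := by
    intro a ha j hj
    have h : a⁻¹ (a j) = j := by simp
    rwa [ha j hj] at h

/-- The vertex `ē = [1,2,…,k]` of `S_{n,k}`. -/
def eVert (n k : ℕ) (h : k ≤ n) : StarVertex n k :=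
  ⟨fun j => ⟨j.1, lt_of_lt_of_le j.2 h⟩, fun a b hab => Fin.ext (by simpa using congrArg Fin.val hab)⟩

/-- The action `φ(μ,ν)` on vertices: `[a_1,…,a_k] ↦ [μ(a_{ν⁻¹(1)}),…,μ(a_{ν⁻¹(k)})]`. -/
def phi (n k : ℕ) (μ : Equiv.Perm (Fin n)) (ν : Equiv.Perm (Fin k))
    (a : StarVertex n k) : StarVertex n k :=
  ⟨fun j => μ (a.1 (ν⁻¹ j)), fun x y hxy =>
    (Equiv.injective ν⁻¹) (a.2 (Equiv.injective μ hxy))⟩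

/-- `φ(μ,ν)` as a permutation of the vertices of `S_{n,k}`. -/
def phiPerm (n k : ℕ) (μ : Equiv.Perm (Fin n)) (ν : Equiv.Perm (Fin k)) :
    Equiv.Perm (StarVertex n k) where
  toFun := phi n k μ ν
  invFun := phi n k μ⁻¹ ν⁻¹
  left_inv a := Subtype.ext (funext fun j => by simp [phi])
  right_inv a := Subtype.ext (funext fun j => by simp [phi])

/-- A subgroup `H ≤ S_n` is `m`-transitive: it acts transitively on the set of
`m`-permutations (injective `m`-tuples). -/
def IsMultTrans (n m : ℕ) (H : Subgroup (Equiv.Perm (Fin n))) : Prop :=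
  ∀ a b : Fin m → Fin n, Function.Injective a → Function.Injective b →
    ∃ μ ∈ H, ∀ j, μ (a j) = b j

/-- A subgroup `H ≤ S_n` is sharply `m`-transitive: it acts regularly on the set of
`m`-permutations (injective `m`-tuples). -/
def IsSharplyMultTrans (n m : ℕ) (H : Subgroup (Equiv.Perm (Fin n))) : Prop :=
  ∀ a b : Fin m → Fin n, Function.Injective a → Function.Injective b →
    ∃! μ : H, ∀ j, (μ : Equiv.Perm (Fin n)) (a j) = b j

theorem isStarEdge_iff_swap {n k : ℕ} [NeZero k] {u v : StarVertex n k} :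
    IsStarEdge u v ↔ ∃ i : Fin k, i ≠ 0 ∧ ∀ m, v.1 m = u.1 (swap 0 i m) := by
  have val_eq_zero (i : Fin k) : i.1 = 0 ↔ i = 0 := by simp
  simp only [IsStarEdge, ne_eq, val_eq_zero, forall_eq]
  refine exists_congr fun i => and_congr_right fun hi => ⟨?_, fun h => ⟨⟨?_, ?_⟩, ?_⟩⟩
  · rintro ⟨⟨h0, h1⟩, h2⟩ m
    rw [swap_apply_def]
    grind
  · simp [h]
  · simp [h]
  · intro m hm0 hmi
    rw [h, swap_apply_of_ne_of_ne hm0 hmi]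

/-- The star edge at position `i` leads from `u` to `u.starSwap i`. -/
def StarVertex.starSwap {n k : ℕ} [NeZero k] (u : StarVertex n k) (i : Fin k) :
    StarVertex n k :=
  ⟨fun m => u.1 (swap 0 i m), u.2.comp (swap 0 i).injective⟩

theorem isStarEdge_iff_eq_starSwap {n k : ℕ} [NeZero k] {u v : StarVertex n k} :
    IsStarEdge u v ↔ ∃ i : Fin k, i ≠ 0 ∧ v = u.starSwap i :=
  isStarEdge_iff_swap.trans <| exists_congr fun _ => and_congr_right fun _ =>
    ⟨fun h => Subtype.ext (funext h), fun h m => congrFun (congrArg Subtype.val h) m⟩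

theorem StarVertex.starSwap_starSwap {n k : ℕ} [NeZero k] (u : StarVertex n k) (i : Fin k) :
    (u.starSwap i).starSwap i = u :=
  Subtype.ext (funext fun m => by simp [starSwap])

/-- A relation of length six between consecutively distinct star transpositions
alternates between two of them. -/
theorem alternating_of_swap_relation {α : Type*} [DecidableEq α] {o i j a b c d : α}
    (hi : i ≠ o) (hj : j ≠ o) (ha : a ≠ o) (hb : b ≠ o)
    (hij : i ≠ j) (hja : j ≠ a) (hab : a ≠ b) (hbc : b ≠ c) (hdi : d ≠ i)
    (h : ∀ m, swap o i (swap o j (swap o a (swap o b (swap o c (swap o d m))))) = m) :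
    a = i ∧ b = j ∧ c = i ∧ d = j := by
  have key (m) : swap o i (swap o j (swap o a m)) = swap o d (swap o c (swap o b m)) := by
    simpa using h (swap o d (swap o c (swap o b m)))
  have h0 := key o
  have hkj := key j
  have hki := key i
  simp only [swap_apply_def] at h0 hkj hki
  grind

theorem swap_alternating_relation {α : Type*} [DecidableEq α] {o i j : α}
    (hi : i ≠ o) (hj : j ≠ o) (hij : i ≠ j) (m : α) :
    swap o i (swap o j (swap o i (swap o j (swap o i (swap o j m))))) = m := by
  simp only [swap_apply_def]
  grind

/-- If `u`, `v`, `w` are distinct vertices of `S_{n,k}` and `uv`, `vw` are star edges, then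
there is a unique star-edge 6-cycle (all six edges star edges) containing `uv` and `vw`;
the cycle is `u ─ v ─ w ─ x ─ y ─ z ─ u` and is recorded by the triple `(x,y,z)` of its
remaining vertices. -/
theorem unique_star_six_cycle (n k : ℕ) (hk : 2 ≤ k) (hn : k + 2 ≤ n)
    (u v w : StarVertex n k) (huv : u ≠ v) (hvw : v ≠ w) (huw : u ≠ w)
    (h1 : IsStarEdge u v) (h2 : IsStarEdge v w) :
    ∃! p : StarVertex n k × StarVertex n k × StarVertex n k,
      [u, v, w, p.1, p.2.1, p.2.2].Pairwise (· ≠ ·) ∧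
      IsStarEdge w p.1 ∧ IsStarEdge p.1 p.2.1 ∧ IsStarEdge p.2.1 p.2.2 ∧
      IsStarEdge p.2.2 u := by
  have : NeZero k := ⟨by omega⟩
  simp only [isStarEdge_iff_eq_starSwap] at h1 h2 ⊢
  obtain ⟨i, hi, rfl⟩ := h1
  obtain ⟨j, hj, rfl⟩ := h2
  have hij : i ≠ j := by
    rintro rfl
    exact huw (u.starSwap_starSwap i).symm
  have hclose : u = (((((u.starSwap i).starSwap j).starSwap i).starSwap j).starSwap
      i).starSwap j :=
    Subtype.ext (funext fun m => congrArg u.1 (swap_alternating_relation hi hj hij m).symm)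
  refine ⟨(((u.starSwap i).starSwap j).starSwap i,
    (((u.starSwap i).starSwap j).starSwap i).starSwap j,
    ((((u.starSwap i).starSwap j).starSwap i).starSwap j).starSwap i), ⟨?_,
      ⟨i, hi, rfl⟩, ⟨j, hj, rfl⟩, ⟨i, hi, rfl⟩, ⟨j, hj, hclose⟩⟩, ?_⟩
  · have separated {x y : StarVertex n k}
        (h : ¬ (x.1 0 = y.1 0 ∧ x.1 i = y.1 i ∧ x.1 j = y.1 j)) : x ≠ y :=
      fun hxy => h (hxy ▸ ⟨rfl, rfl, rfl⟩)
    simp only [List.pairwise_cons, List.mem_cons, forall_eq_or_imp, List.not_mem_nil,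
      false_imp_iff, implies_true, and_true, List.Pairwise.nil]
    refine ⟨⟨?_, ?_, ?_, ?_, ?_⟩, ⟨?_, ?_, ?_, ?_⟩, ⟨?_, ?_, ?_⟩, ⟨?_, ?_⟩, ?_⟩ <;>
    · apply separated
      simp only [StarVertex.starSwap, u.2.eq_iff, swap_apply_def]
      grind
  · rintro ⟨x, y, z⟩ ⟨hp, hx, hy, hz, hu⟩
    dsimp only at hp hx hy hz hu ⊢
    obtain ⟨a, ha, rfl⟩ := hx
    obtain ⟨b, hb, rfl⟩ := hy
    obtain ⟨c, -, rfl⟩ := hz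
    obtain ⟨d, -, hu⟩ := hu
    simp only [List.pairwise_cons, List.mem_cons, forall_eq_or_imp, List.not_mem_nil,
      false_imp_iff, implies_true, and_true, List.Pairwise.nil] at hp
    obtain ⟨-, ⟨-, hvx, -, hvz⟩, ⟨-, hwy, -⟩, ⟨-, hxz⟩, -⟩ := hp
    have hja : j ≠ a := by rintro rfl; exact hvx (StarVertex.starSwap_starSwap _ _).symm
    have hab : a ≠ b := by rintro rfl; exact hwy (StarVertex.starSwap_starSwap _ _).symm
    have hbc : b ≠ c := by rintro rfl; exact hxz (StarVertex.starSwap_starSwap _ _).symm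
    have hdi : d ≠ i := by
      rintro rfl
      exact hvz ((congrArg (·.starSwap d) hu).trans (StarVertex.starSwap_starSwap _ _))
    obtain ⟨rfl, rfl, rfl, rfl⟩ := alternating_of_swap_relation hi hj ha hb hij hja hab
      hbc hdi fun m => (u.2 (congrFun (congrArg Subtype.val hu) m)).symm
    rfl
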